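/- arXiv:2312.07918 — 2 statements merged into one kernel-verified Lean document; each statement's English description precedes it below -/
import Mathlib

section
/- Let n ≥ 2, m ≥ 1, k ≥ 2, and let P: ℝⁿ → ℝ^m be a map, not identically zero, each of whose components is either zero or a homogeneous harmonic polynomial of degree k. Define L = { y ∈ ℝⁿ : all partial derivatives ∂^β P^j(y) of order |β| ≤ k−1 of all components P^j vanish at y }. Then the linear subspace L has dimension at most n − 2. -/
/-- The Euclidean Laplacian `Σ_j ∂_j² P` of a scalar function on `ℝⁿ`. -/
noncomputable def lapl {n : ℕ} (P : EuclideanSpace ℝ (Fin n) → ℝ)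
    (x : EuclideanSpace ℝ (Fin n)) : ℝ :=
  ∑ j, fderiv ℝ (fun y => fderiv ℝ P y (EuclideanSpace.single j 1)) x
    (EuclideanSpace.single j 1)

open Filter Topology Asymptotics

theorem MvPolynomial.exists_polynomial_eval_add_mul {σ R : Type*} [CommRing R]
    (p : MvPolynomial σ R) (a b : σ → R) :
    ∃ q : Polynomial R, ∀ s, q.eval s = MvPolynomial.eval (fun l => a l + s * b l) p := by
  refine ⟨MvPolynomial.aeval (fun l => Polynomial.C (a l) + Polynomial.C (b l) * Polynomial.X) p,
    fun s => ?_⟩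
  induction p using MvPolynomial.induction_on with
  | C r => simp
  | add p q hp hq => simp [hp, hq]
  | mul_X p l hp => simp [hp, mul_comm s]

theorem Polynomial.eq_of_forall_pos_eval_eq {p q : Polynomial ℝ}
    (h : ∀ s : ℝ, 0 < s → p.eval s = q.eval s) : p = q :=
  Polynomial.eq_of_infinite_eval_eq p q ((Set.Ioi_infinite 0).mono h)

theorem AnalyticAt.isBigO_of_iteratedFDeriv_eq_zero {E F : Type*} [NormedAddCommGroup E]
    [NormedSpace ℝ E] [NormedAddCommGroup F] [NormedSpace ℝ F] [CompleteSpace F]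
    {f : E → F} {y : E} {k : ℕ} (hf : AnalyticAt ℝ f y)
    (h : ∀ i < k, iteratedFDeriv ℝ i f y = 0) :
    (fun v => f (y + v)) =O[𝓝 0] fun v => ‖v‖ ^ k := by
  obtain ⟨p, r, hp⟩ := hf
  have key := hp.hasFPowerSeriesAt.isBigO_sub_partialSum_pow k
  refine key.congr_left fun v => ?_
  have : p.partialSum k v = 0 := by
    refine Finset.sum_eq_zero fun i hi => ?_
    have h1 := hp.factorial_smul v i
    rw [h i (Finset.mem_range.1 hi)] at h1
    rw [zero_apply, ← Nat.cast_smul_eq_nsmul ℝ] at h1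
    exact (smul_eq_zero.1 h1).resolve_left (by exact_mod_cast i.factorial_ne_zero)
  simp [this]

theorem iteratedFDeriv_zero_eq_zero_of_homogeneous {E F : Type*} [NormedAddCommGroup E]
    [NormedSpace ℝ E] [NormedAddCommGroup F] [NormedSpace ℝ F] {f : E → F} {k i : ℕ}
    (hf : ContDiff ℝ i f) (hom : ∀ x, f ((2 : ℝ) • x) = (2 : ℝ) ^ k • f x) (hi : i < k) :
    iteratedFDeriv ℝ i f 0 = 0 := by
  let g : E →L[ℝ] E := (2 : ℝ) • ContinuousLinearMap.id ℝ E
  have h1 := g.iteratedFDeriv_comp_right hf 0 le_rfl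
  have h2 : f ∘ g = fun x => (2 : ℝ) ^ k • f x := by
    ext x; simp [g, hom]
  rw [h2, iteratedFDeriv_const_smul_apply' (by fun_prop)] at h1
  ext v
  have h3 := congrArg (fun m => m v) h1
  simp only [g, smul_apply, map_zero,
    ContinuousMultilinearMap.compContinuousLinearMap_apply,
    ContinuousLinearMap.id_apply] at h3
  rw [ContinuousMultilinearMap.map_smul_univ, ← sub_eq_zero, ← sub_smul] at h3
  simp only [Finset.prod_const, Finset.card_univ, Fintype.card_fin, smul_eq_zero,
    sub_eq_zero] at h3
  exact h3.resolve_left (pow_right_injective₀ (by norm_num) (by norm_num) |>.ne hi.ne')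

/-- The translations leaving a function invariant, when they are stable under scaling. -/
theorem exists_submodule_eq_setOf_periods {E F : Type*} [NormedAddCommGroup E]
    [NormedSpace ℝ E] (f : E → F) (hsmul : ∀ v, (∀ x, f (x + v) = f x) →
      ∀ c : ℝ, ∀ x, f (x + c • v) = f x) :
    ∃ W : Submodule ℝ E, (W : Set E) = {v | ∀ x, f (x + v) = f x} :=
  ⟨{ carrier := {v | ∀ x, f (x + v) = f x}
     add_mem' := fun {a b} ha hb x => by rw [← add_assoc, hb, ha]
     zero_mem' := fun x => by simp
     smul_mem' := fun c v hv => hsmul v hv c }, rfl⟩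

section Homogeneous

variable {n k : ℕ} {f : EuclideanSpace ℝ (Fin n) → ℝ} {p : MvPolynomial (Fin n) ℝ}

theorem exists_polynomial_eval_line (hp : ∀ x, f x = MvPolynomial.eval (fun l => x l) p)
    (x y : EuclideanSpace ℝ (Fin n)) : ∃ q : Polynomial ℝ, ∀ s, q.eval s = f (x + s • y) := by
  obtain ⟨q, hq⟩ := p.exists_polynomial_eval_add_mul (fun l => x l) (fun l => y l)
  exact ⟨q, fun s => by simp [hq, hp]⟩

theorem homogeneous_of_pos (hp : ∀ x, f x = MvPolynomial.eval (fun l => x l) p)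
    (hom : ∀ t : ℝ, 0 < t → ∀ x, f (t • x) = t ^ k * f x) (t : ℝ)
    (x : EuclideanSpace ℝ (Fin n)) : f (t • x) = t ^ k * f x := by
  obtain ⟨q, hq⟩ := exists_polynomial_eval_line hp 0 x
  have : q = Polynomial.C (f x) * Polynomial.X ^ k :=
    Polynomial.eq_of_forall_pos_eval_eq fun s hs => by simp [hq, hom s hs, mul_comm (f x)]
  simpa [this, mul_comm (f x)] using (hq t).symm

theorem add_smul_eq_of_isBigO (hp : ∀ x, f x = MvPolynomial.eval (fun l => x l) p)
    (hom : ∀ t : ℝ, 0 < t → ∀ x, f (t • x) = t ^ k * f x) {y : EuclideanSpace ℝ (Fin n)}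
    (hy : (fun v => f (y + v)) =O[𝓝 0] fun v => ‖v‖ ^ k) (c : ℝ)
    (x : EuclideanSpace ℝ (Fin n)) : f (x + c • y) = f x := by
  obtain ⟨q, hq⟩ := exists_polynomial_eval_line hp x y
  have hlim : Tendsto (fun s : ℝ => s⁻¹ • x) atTop (𝓝 0) := by
    simpa using (tendsto_inv_atTop_zero (𝕜 := ℝ)).smul_const x
  obtain ⟨C, hC⟩ := (hy.comp_tendsto hlim).bound
  have hbdd : IsBoundedUnder (· ≤ ·) atTop fun s => |q.eval s| := by
    refine ⟨C * ‖x‖ ^ k, eventually_map.2 ?_⟩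
    filter_upwards [hC, eventually_gt_atTop 0] with s hs hs0
    have hfs : f (x + s • y) = s ^ k * f (y + s⁻¹ • x) := by
      rw [← hom s hs0, smul_add, smul_inv_smul₀ hs0.ne', add_comm]
    rw [hq, hfs, abs_mul, abs_of_pos (pow_pos hs0 k)]
    simp only [Function.comp_apply, Real.norm_eq_abs, norm_smul, abs_pow, abs_mul, abs_norm,
      abs_inv, abs_of_pos hs0, mul_pow, inv_pow] at hs
    calc s ^ k * |f (y + s⁻¹ • x)| ≤ s ^ k * (C * ((s ^ k)⁻¹ * ‖x‖ ^ k)) := by gcongr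
      _ = C * ‖x‖ ^ k := by field_simp
  have hdeg := q.isBoundedUnder_abs_atTop_iff.1 hbdd
  have h0 := hq 0
  rw [Polynomial.eq_C_of_degree_le_zero hdeg] at hq h0
  have hc := hq c
  simp only [Polynomial.eval_C, zero_smul, add_zero] at hc h0
  rw [← hc, h0]

theorem lapl_inner_pow_mul (u : EuclideanSpace ℝ (Fin n)) (a : ℝ)
    (x : EuclideanSpace ℝ (Fin n)) :
    lapl (fun y => inner ℝ u y ^ k * a) x
      = k * (k - 1 : ℕ) * inner ℝ u x ^ (k - 1 - 1) * a * ‖u‖ ^ 2 := by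
  have hpow : ∀ (j : ℕ) (b : ℝ) (y v : EuclideanSpace ℝ (Fin n)),
      fderiv ℝ (fun y => inner ℝ u y ^ j * b) y v
        = inner ℝ u y ^ (j - 1) * (j * b * inner ℝ u v) := by
    intro j b y v
    have h := (((innerSL ℝ u).hasFDerivAt (x := y)).pow j).mul_const b
    have h' : HasFDerivAt (fun y => inner ℝ u y ^ j * b) _ y := h
    rw [h'.fderiv]
    simp
    ring
  simp only [lapl, hpow]
  rw [EuclideanSpace.real_norm_sq_eq, Finset.mul_sum]
  refine Finset.sum_congr rfl fun j _ => ?_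
  simp [EuclideanSpace.inner_single_right]
  ring

theorem eq_zero_of_harmonic_of_depends_on_inner (hk : 2 ≤ k)
    (hom : ∀ (t : ℝ) x, f (t • x) = t ^ k * f x) (hlapl : ∀ x, lapl f x = 0)
    {u : EuclideanSpace ℝ (Fin n)} (hu : ‖u‖ = 1)
    (hf : ∀ x, f x = f (inner ℝ u x • u)) (x : EuclideanSpace ℝ (Fin n)) : f x = 0 := by
  have hform : f = fun y => inner ℝ u y ^ k * f u := by
    ext y; rw [hf, hom]
  have h := hlapl u
  rw [hform, lapl_inner_pow_mul] at h
  have h1 : (k : ℝ) ≠ 0 := by positivity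
  have h2 : ((k - 1 : ℕ) : ℝ) ≠ 0 := by
    rw [Nat.cast_ne_zero]; omega
  have h3 : f u = 0 := by simpa [hu, h1, h2] using h
  rw [hf, hom, h3, mul_zero]

end Homogeneous

theorem Submodule.eq_top_or_exists_unit_sub_inner_smul_mem {E : Type*} [NormedAddCommGroup E]
    [InnerProductSpace ℝ E] [FiniteDimensional ℝ E] (W : Submodule ℝ E)
    (hW : Module.finrank ℝ E ≤ Module.finrank ℝ W + 1) :
    W = ⊤ ∨ ∃ u : E, ‖u‖ = 1 ∧ ∀ x, x - inner ℝ u x • u ∈ W := by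
  have hsum := W.finrank_add_finrank_orthogonal
  by_cases hbot : Wᗮ = ⊥
  · exact Or.inl (W.orthogonal_eq_bot_iff.1 hbot)
  right
  obtain ⟨e, he, he0⟩ := Submodule.exists_mem_ne_zero_of_ne_bot hbot
  have hu : ‖(‖e‖⁻¹ • e)‖ = 1 := norm_smul_inv_norm (𝕜 := ℝ) he0
  refine ⟨‖e‖⁻¹ • e, hu, fun x => ?_⟩
  have huW : ‖e‖⁻¹ • e ∈ Wᗮ := Wᗮ.smul_mem _ he
  set u := ‖e‖⁻¹ • e
  have hspan : ℝ ∙ u = Wᗮ := by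
    refine Submodule.eq_of_le_of_finrank_le ((Submodule.span_singleton_le_iff_mem _ _).2 huW) ?_
    rw [finrank_span_singleton (norm_ne_zero_iff.1 (by simp [hu]))]
    omega
  rw [← W.orthogonal_orthogonal, ← hspan, Submodule.mem_orthogonal_singleton_iff_inner_right]
  simp [inner_sub_right, inner_smul_right, hu]

/-- For a nonzero map `P : ℝⁿ → ℝ^m`, `k ≥ 2`, whose components are zero or homogeneous
harmonic polynomials of degree `k`, the subspace of points where all derivatives of order
`≤ k-1` vanish has dimension at most `n - 2`. -/
theorem singular_subspace_dim_le {n m k : ℕ} (hn : 2 ≤ n) (hm : 1 ≤ m) (hk : 2 ≤ k)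
    (P : EuclideanSpace ℝ (Fin n) → EuclideanSpace ℝ (Fin m))
    (hcomp : ∀ i : Fin m, (∀ x, P x i = 0) ∨
      ((∃ p : MvPolynomial (Fin n) ℝ, ∀ x, P x i = MvPolynomial.eval (fun l => x l) p) ∧
        (∀ t : ℝ, 0 < t → ∀ x, P (t • x) i = t ^ k * P x i) ∧
        (∀ x, lapl (fun y => P y i) x = 0)))
    (hne : P ≠ 0)
    (L : Set (EuclideanSpace ℝ (Fin n)))
    (hL : L = {y | ∀ i ≤ k - 1, iteratedFDeriv ℝ i P y = 0}) :
    ∃ L' : Submodule ℝ (EuclideanSpace ℝ (Fin n)),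
      (L' : Set (EuclideanSpace ℝ (Fin n))) = L ∧ Module.finrank ℝ L' ≤ n - 2 := by
  replace hcomp : ∀ i : Fin m,
      (∃ p : MvPolynomial (Fin n) ℝ, ∀ x, P x i = MvPolynomial.eval (fun l => x l) p) ∧
        (∀ t : ℝ, 0 < t → ∀ x, P (t • x) i = t ^ k * P x i) ∧
        (∀ x, lapl (fun y => P y i) x = 0) := by
    intro i
    refine (hcomp i).elim (fun h => ⟨⟨0, by simp [h]⟩, by simp [h], fun x => ?_⟩) id
    simp [h, lapl]
  choose p hp using fun i => (hcomp i).1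
  have hpos := fun i => (hcomp i).2.1
  have hlapl := fun i => (hcomp i).2.2
  have hom : ∀ i (t : ℝ) x, P (t • x) i = t ^ k * P x i := fun i =>
    homogeneous_of_pos (hp i) (hpos i)
  have hP : AnalyticOnNhd ℝ P Set.univ := by
    rw [← contDiff_omega_iff_analyticOnNhd, contDiff_euclidean]
    intro i
    rw [contDiff_omega_iff_analyticOnNhd]
    intro x _
    simp only [hp]
    exact AnalyticAt.aeval_mvPolynomial (𝕜 := ℝ) (z := x)
      (f := fun (x : EuclideanSpace ℝ (Fin n)) l => x l)
      (fun l => (EuclideanSpace.proj (𝕜 := ℝ) l).analyticAt x) (p i)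
  have hLinv : ∀ y ∈ L, ∀ (c : ℝ) x, P (x + c • y) = P x := by
    intro y hy c x
    rw [hL] at hy
    have hO := (hP y trivial).isBigO_of_iteratedFDeriv_eq_zero
      (k := k) fun i hi => hy i (by omega)
    ext i
    refine add_smul_eq_of_isBigO (hp i) (hpos i) (IsBigO.trans ?_ hO) c x
    exact IsBigO.of_bound 1 (.of_forall fun v => by
      simpa using PiLp.norm_apply_le (P (y + v)) i)
  have hLeq : L = {v | ∀ x, P (x + v) = P x} := by
    refine Set.Subset.antisymm (fun y hy x => by simpa using hLinv y hy 1 x) fun y hy => ?_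
    rw [hL]
    intro i hi
    have hshift : (fun x => P (x + y)) = P := funext hy
    have h := iteratedFDeriv_comp_add_right (𝕜 := ℝ) (f := P) i y 0
    rw [hshift, zero_add] at h
    rw [← h]
    refine iteratedFDeriv_zero_eq_zero_of_homogeneous (k := k) hP.contDiff (fun x => ?_) (by omega)
    ext j
    simp [hom]
  obtain ⟨W, hW⟩ := exists_submodule_eq_setOf_periods P fun v hv => hLinv v (hLeq ▸ hv)
  refine ⟨W, hW.trans hLeq.symm, ?_⟩
  have hmem : ∀ v ∈ W, ∀ x, P (x + v) = P x := fun v hv => hW.subset hv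
  by_contra! hlt
  refine hne (funext fun x => ?_)
  ext i
  rcases W.eq_top_or_exists_unit_sub_inner_smul_mem
    (by rw [finrank_euclideanSpace_fin]; omega) with htop | ⟨u, hu, huW⟩
  · have h := hmem x (htop ▸ Submodule.mem_top) 0
    have h0 := hom i 0 0
    rw [zero_add] at h
    rw [h]
    simpa [show k ≠ 0 by omega] using h0
  · refine eq_zero_of_harmonic_of_depends_on_inner hk (hom i) (hlapl i) hu (fun y => ?_) x
    have h := hmem _ (huW y) (inner ℝ u y • u)
    rw [add_sub_cancel] at h
    rw [h]
end

section
/- Let Ω ⊆ ℝⁿ be a nonempty open connected set, α ∈ (0,1), and let φ: Ω → ℂ^N be a map of class C^{1,α} satisfying Dφ(x) = V(φ(x)) for all x ∈ Ω, where V: ℂ^N → ℂ^N satisfies V(0) = 0 and is Lipschitz on some neighborhood of 0 in ℂ^N. If φ vanishes identically on some nonempty open subset of Ω, then φ vanishes identically on all of Ω (unique continuation). -/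
open MeasureTheory

/-- The Euclidean Dirac operator `Dφ = Σ_j γ_j ∂_j φ`. -/
noncomputable def dirac {n N : ℕ} (γ : Fin n → Matrix (Fin N) (Fin N) ℂ)
    (φ : EuclideanSpace ℝ (Fin n) → EuclideanSpace ℂ (Fin N))
    (x : EuclideanSpace ℝ (Fin n)) : EuclideanSpace ℂ (Fin N) :=
  (WithLp.equiv 2 (Fin N → ℂ)).symm
    (∑ j, (γ j).mulVec
      (WithLp.equiv 2 (Fin N → ℂ) (fderiv ℝ φ x (EuclideanSpace.single j 1))))

/-- `φ` is of class `C^{1,α}` on `s`. -/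
def IsC1Holder {n N : ℕ} (α : ℝ)
    (φ : EuclideanSpace ℝ (Fin n) → EuclideanSpace ℂ (Fin N))
    (s : Set (EuclideanSpace ℝ (Fin n))) : Prop :=
  ContDiffOn ℝ 1 φ s ∧ ∃ C : NNReal, HolderOnWith C α.toNNReal (fun x => fderiv ℝ φ x) s


theorem HasCompactSupport.bilin_left {X F : Type*} [TopologicalSpace X]
    [NormedAddCommGroup F] [NormedSpace ℝ F] (S : F →L[ℝ] F →L[ℝ] ℝ) {f g : X → F}
    (hf : HasCompactSupport f) : HasCompactSupport fun x ↦ S (f x) (g x) :=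
  hf.mono fun x hx hfx ↦ hx (by simp [hfx])

theorem HasCompactSupport.bilin_right {X F : Type*} [TopologicalSpace X]
    [NormedAddCommGroup F] [NormedSpace ℝ F] (S : F →L[ℝ] F →L[ℝ] ℝ) {f g : X → F}
    (hg : HasCompactSupport g) : HasCompactSupport fun x ↦ S (f x) (g x) :=
  hg.mono fun x hx hfx ↦ hx (by simp [hfx])

section CompactlySupported

open Filter Topology

variable {X F : Type*} [NormedAddCommGroup X] [NormedSpace ℝ X]
  [NormedAddCommGroup F] [NormedSpace ℝ F]

theorem tendsto_integral_bilin_slope [MeasurableSpace X] [BorelSpace X] [FiniteDimensional ℝ X]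
    (μ : Measure X) [IsFiniteMeasureOnCompacts μ] (S : F →L[ℝ] F →L[ℝ] ℝ) {g v : X → F}
    (hg : Continuous g) (hgc : HasCompactSupport g)
    (hv : ContDiff ℝ 1 v) (hvc : HasCompactSupport v) (b : X) :
    Tendsto (fun t : ℝ ↦ ∫ x, S (g x) (t⁻¹ • (v (x + t • b) - v x)) ∂μ) (𝓝[>] 0)
      (𝓝 (∫ x, S (g x) (fderiv ℝ v x b) ∂μ)) := by
  obtain ⟨C, hC⟩ := ContDiff.lipschitzWith_of_hasCompactSupport hvc hv one_ne_zero
  have hcont := hv.continuous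
  have hSc : Continuous fun p : F × F ↦ S p.1 p.2 := by fun_prop
  refine tendsto_integral_filter_of_dominated_convergence
    (fun x ↦ ‖S‖ * ‖g x‖ * (C * ‖b‖)) ?_ ?_ ?_ ?_
  · refine .of_forall fun t ↦ ?_
    refine Continuous.aestronglyMeasurable ?_
    fun_prop
  · filter_upwards [self_mem_nhdsWithin] with t (ht : 0 < t)
    refine .of_forall fun x ↦ (S.le_opNorm₂ _ _).trans ?_
    gcongr
    rw [norm_smul, norm_inv, Real.norm_of_nonneg ht.le, inv_mul_le_iff₀ ht]
    refine (hC.norm_sub_le _ _).trans_eq ?_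
    rw [add_sub_cancel_left, norm_smul, Real.norm_of_nonneg ht.le]
    ring
  · refine Continuous.integrable_of_hasCompactSupport (by fun_prop) ?_
    exact (hgc.norm.mul_left (f := fun _ ↦ ‖S‖)).mul_right
  · refine .of_forall fun x ↦ ?_
    have := ((hv.differentiable one_ne_zero x).hasFDerivAt.hasLineDerivAt b).tendsto_slope_zero_right
    exact ((S (g x)).continuous.tendsto _).comp this

variable [MeasurableSpace X] [BorelSpace X] [FiniteDimensional ℝ X]
  (μ : Measure X) [μ.IsAddHaarMeasure]

theorem integral_bilin_fderiv_fderiv_comm (S : F →L[ℝ] F →L[ℝ] ℝ) {u v : X → F}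
    (hu : ContDiff ℝ 1 u) (huc : HasCompactSupport u)
    (hv : ContDiff ℝ 1 v) (hvc : HasCompactSupport v) (a b : X) :
    ∫ x, S (fderiv ℝ u x a) (fderiv ℝ v x b) ∂μ
      = ∫ x, S (fderiv ℝ u x b) (fderiv ℝ v x a) ∂μ := by
  have hu' : Continuous fun x ↦ fderiv ℝ u x a :=
    (hu.continuous_fderiv one_ne_zero).clm_apply continuous_const
  have hv' : Continuous fun x ↦ fderiv ℝ v x a :=
    (hv.continuous_fderiv one_ne_zero).clm_apply continuous_const
  have huc' : HasCompactSupport fun x ↦ fderiv ℝ u x a := huc.fderiv_apply ℝ a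
  have hvc' : HasCompactSupport fun x ↦ fderiv ℝ v x a := hvc.fderiv_apply ℝ a
  have h₁ := tendsto_integral_bilin_slope μ S hu' huc' hv hvc b
  have h₂ := tendsto_integral_bilin_slope μ S.flip hv' hvc' hu huc (-b)
  have hS : Continuous fun p : F × F ↦ S p.1 p.2 := by fun_prop
  have hcu := hu.continuous
  have hcv := hv.continuous
  have key : ∀ t : ℝ, ∫ x, S (fderiv ℝ u x a) (t⁻¹ • (v (x + t • b) - v x)) ∂μ
      = - ∫ x, S.flip (fderiv ℝ v x a) (t⁻¹ • (u (x + t • -b) - u x)) ∂μ := by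
    intro t
    have hvt : ContDiff ℝ 1 fun x ↦ v (x + t • b) := hv.comp (contDiff_id.add contDiff_const)
    have hvt' : ∀ x, fderiv ℝ (fun x ↦ v (x + t • b)) x a = fderiv ℝ v (x + t • b) a := fun x ↦ by
      rw [fderiv_comp_add_right]
    have hvt'c : Continuous fun x ↦ fderiv ℝ v (x + t • b) a :=
      hv'.comp (continuous_id.add continuous_const)
    have i₁ : Integrable (fun x ↦ S (fderiv ℝ u x a) (v (x + t • b))) μ :=
      Continuous.integrable_of_hasCompactSupport (by fun_prop) (huc'.bilin_left S)
    have i₂ : Integrable (fun x ↦ S (fderiv ℝ u x a) (v x)) μ :=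
      Continuous.integrable_of_hasCompactSupport (by fun_prop) (huc'.bilin_left S)
    have i₃ : Integrable (fun x ↦ S (u x) (fderiv ℝ v (x + t • b) a)) μ :=
      Continuous.integrable_of_hasCompactSupport (by fun_prop) (huc.bilin_left S)
    have i₄ : Integrable (fun x ↦ S (u x) (fderiv ℝ v x a)) μ :=
      Continuous.integrable_of_hasCompactSupport (by fun_prop) (huc.bilin_left S)
    have i₅ : Integrable (fun x ↦ S (u x) (v (x + t • b))) μ :=
      Continuous.integrable_of_hasCompactSupport (by fun_prop) (huc.bilin_left S)
    have i₆ : Integrable (fun x ↦ S (u x) (v x)) μ :=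
      Continuous.integrable_of_hasCompactSupport (by fun_prop) (huc.bilin_left S)
    have i₇ : Integrable (fun x ↦ S (u (x + t • -b)) (fderiv ℝ v x a)) μ :=
      Continuous.integrable_of_hasCompactSupport (by fun_prop) (hvc'.bilin_right S)
    have e₁ : ∫ x, S (u x) (fderiv ℝ v x a) ∂μ = - ∫ x, S (fderiv ℝ u x a) (v x) ∂μ :=
      integral_bilinear_fderiv_right_eq_neg_left_of_integrable i₂ i₄ i₆
        (fun x _ ↦ hu.differentiable one_ne_zero x) (fun x _ ↦ hv.differentiable one_ne_zero x)
    have e₂ : ∫ x, S (u x) (fderiv ℝ v (x + t • b) a) ∂μ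
        = - ∫ x, S (fderiv ℝ u x a) (v (x + t • b)) ∂μ := by
      have := integral_bilinear_fderiv_right_eq_neg_left_of_integrable (μ := μ) (f := u)
        (g := fun x ↦ v (x + t • b)) (v := a) (B := S) i₁ (by simpa only [hvt'] using i₃) i₅
        (fun x _ ↦ hu.differentiable one_ne_zero x) (fun x _ ↦ hvt.differentiable one_ne_zero x)
      simpa only [hvt'] using this
    have e₃ : ∫ x, S (u x) (fderiv ℝ v (x + t • b) a) ∂μ
        = ∫ x, S (u (x + t • -b)) (fderiv ℝ v x a) ∂μ := by
      rw [← integral_add_right_eq_self (μ := μ)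
        (fun x ↦ S (u (x + t • -b)) (fderiv ℝ v x a)) (t • b)]
      simp
    simp only [map_smul, map_sub, ContinuousLinearMap.flip_apply, smul_eq_mul]
    rw [integral_const_mul, integral_const_mul, integral_sub i₁ i₂, integral_sub i₇ i₄]
    linear_combination t⁻¹ * (e₂ - e₁ - e₃)
  simp_rw [key] at h₁
  have := tendsto_nhds_unique h₁ h₂.neg
  rw [this, ← integral_neg]
  simp

theorem integral_fderiv_apply_eq_zero {f : X → ℝ} (hf : ContDiff ℝ 1 f)
    (hfc : HasCompactSupport f) (a : X) : ∫ x, fderiv ℝ f x a ∂μ = 0 := by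
  have hf' : Continuous fun x ↦ fderiv ℝ f x a :=
    (hf.continuous_fderiv one_ne_zero).clm_apply continuous_const
  have := integral_mul_fderiv_eq_neg_fderiv_mul_of_integrable (μ := μ) (f := fun _ : X ↦ (1 : ℝ))
    (g := f) (v := a) (by simp)
    (by simpa using hf'.integrable_of_hasCompactSupport (hfc.fderiv_apply ℝ a))
    (by simpa using hf.continuous.integrable_of_hasCompactSupport hfc)
    (fun x _ ↦ differentiableAt_const _) (fun x _ ↦ hf.differentiable one_ne_zero x)
  simpa using this

end CompactlySupported

section Euler

variable {n : ℕ} {F : Type*} [NormedAddCommGroup F] [NormedSpace ℝ F]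

theorem ContinuousLinearMap.apply_eq_sum_single (L : EuclideanSpace ℝ (Fin n) →L[ℝ] F)
    (x : EuclideanSpace ℝ (Fin n)) : L x = ∑ l, x l • L (EuclideanSpace.single l 1) := by
  conv_lhs => rw [← (EuclideanSpace.basisFun (Fin n) ℝ).sum_repr x]
  simp

theorem integral_euler_add_eq_zero {G : EuclideanSpace ℝ (Fin n) → ℝ} (hG : ContDiff ℝ 1 G)
    (hGc : HasCompactSupport G) : ∫ x, (fderiv ℝ G x x + n * G x) = 0 := by
  have hc (l : Fin n) : ContDiff ℝ 1 fun x : EuclideanSpace ℝ (Fin n) ↦ x l * G x := by fun_prop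
  have hs (l : Fin n) : HasCompactSupport fun x : EuclideanSpace ℝ (Fin n) ↦ x l * G x :=
    hGc.mul_left
  have hint (l : Fin n) := ((hc l).continuous_fderiv one_ne_zero).clm_apply
    (continuous_const (y := EuclideanSpace.single l (1 : ℝ))) |>.integrable_of_hasCompactSupport
    (μ := volume) ((hs l).fderiv_apply ℝ (EuclideanSpace.single l 1))
  have hd (l : Fin n) (x : EuclideanSpace ℝ (Fin n)) :
      fderiv ℝ (fun x : EuclideanSpace ℝ (Fin n) ↦ x l * G x) x (EuclideanSpace.single l 1)
        = x l * fderiv ℝ G x (EuclideanSpace.single l 1) + G x := by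
    have h := (EuclideanSpace.proj (𝕜 := ℝ) l).hasFDerivAt (x := x) |>.mul
      (hG.differentiable one_ne_zero x).hasFDerivAt
    refine (congrArg (· (EuclideanSpace.single l (1 : ℝ))) h.fderiv).trans ?_
    simp
  calc ∫ x, (fderiv ℝ G x x + n * G x)
      = ∫ x, ∑ l, fderiv ℝ (fun x : EuclideanSpace ℝ (Fin n) ↦ x l * G x) x
          (EuclideanSpace.single l 1) := by
        congr with x
        simp only [hd, Finset.sum_add_distrib]
        rw [ContinuousLinearMap.apply_eq_sum_single]
        simp
    _ = 0 := by
        rw [integral_finsetSum _ fun l _ ↦ hint l]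
        exact Finset.sum_eq_zero fun l _ ↦ integral_fderiv_apply_eq_zero _ (hc l) (hs l) _

theorem integral_skew_euler_eq_zero (S : F →L[ℝ] F →L[ℝ] ℝ) (hS : ∀ u v, S u v = - S v u)
    {v : EuclideanSpace ℝ (Fin n) → F} (hv : ContDiff ℝ 1 v) (hvc : HasCompactSupport v)
    {j k : Fin n} (hjk : j ≠ k) :
    ∫ x, x j * S ((2 : ℝ) • fderiv ℝ v x x + (n : ℝ) • v x)
      (fderiv ℝ v x (EuclideanSpace.single k 1)) = 0 := by
  set e : Fin n → EuclideanSpace ℝ (Fin n) := fun l ↦ EuclideanSpace.single l 1 with he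
  have hu (l : Fin n) : ContDiff ℝ 1 fun x : EuclideanSpace ℝ (Fin n) ↦ (x l * x j) • v x := by
    fun_prop
  have huc (l : Fin n) :
      HasCompactSupport fun x : EuclideanSpace ℝ (Fin n) ↦ (x l * x j) • v x := hvc.smul_left
  have hS' : Continuous fun p : F × F ↦ S p.1 p.2 := by fun_prop
  have hcu (l : Fin n) (d : EuclideanSpace ℝ (Fin n)) : Continuous fun x ↦
      fderiv ℝ (fun x : EuclideanSpace ℝ (Fin n) ↦ (x l * x j) • v x) x d :=
    ((hu l).continuous_fderiv one_ne_zero).clm_apply continuous_const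
  have hcv (d : EuclideanSpace ℝ (Fin n)) : Continuous fun x ↦ fderiv ℝ v x d :=
    (hv.continuous_fderiv one_ne_zero).clm_apply continuous_const
  have hint (l : Fin n) (d d' : EuclideanSpace ℝ (Fin n)) : Integrable fun x ↦
      S (fderiv ℝ (fun x : EuclideanSpace ℝ (Fin n) ↦ (x l * x j) • v x) x d) (fderiv ℝ v x d') :=
    (hS'.comp ((hcu l d).prodMk (hcv d'))).integrable_of_hasCompactSupport
      ((hvc.fderiv_apply ℝ d').bilin_right S)
  have hd (l : Fin n) (x d : EuclideanSpace ℝ (Fin n)) :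
      fderiv ℝ (fun x : EuclideanSpace ℝ (Fin n) ↦ (x l * x j) • v x) x d
        = (x l * x j) • fderiv ℝ v x d + (x l * d j + x j * d l) • v x := by
    have h := ((EuclideanSpace.proj (𝕜 := ℝ) l).hasFDerivAt (x := x) |>.mul
      ((EuclideanSpace.proj (𝕜 := ℝ) j).hasFDerivAt (x := x))).smul
      (hv.differentiable one_ne_zero x).hasFDerivAt
    refine (congrArg (· d) h.fderiv).trans ?_
    simp
  calc ∫ x, x j * S ((2 : ℝ) • fderiv ℝ v x x + (n : ℝ) • v x) (fderiv ℝ v x (e k))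
      = ∫ x, ∑ l, (S (fderiv ℝ (fun x : EuclideanSpace ℝ (Fin n) ↦ (x l * x j) • v x) x (e l))
            (fderiv ℝ v x (e k))
          - S (fderiv ℝ (fun x : EuclideanSpace ℝ (Fin n) ↦ (x l * x j) • v x) x (e k))
            (fderiv ℝ v x (e l))) := by
        congr with x
        have h₁ : S (fderiv ℝ v x x) (fderiv ℝ v x (e k))
            = ∑ l, x l * S (fderiv ℝ v x (e l)) (fderiv ℝ v x (e k)) := by
          rw [ContinuousLinearMap.apply_eq_sum_single]
          simp [he]
        have h₂ (l : Fin n) :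
            S (fderiv ℝ (fun x : EuclideanSpace ℝ (Fin n) ↦ (x l * x j) • v x) x (e l))
              (fderiv ℝ v x (e k))
            - S (fderiv ℝ (fun x : EuclideanSpace ℝ (Fin n) ↦ (x l * x j) • v x) x (e k))
              (fderiv ℝ v x (e l))
            = 2 * x j * (x l * S (fderiv ℝ v x (e l)) (fderiv ℝ v x (e k)))
              + x j * S (v x) (fderiv ℝ v x (e k))
              + ((if l = j then x j * S (v x) (fderiv ℝ v x (e k)) else 0)
              - if l = k then x j * S (v x) (fderiv ℝ v x (e k)) else 0) := by
          rw [hd, hd]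
          simp only [map_add, map_smul, add_apply, smul_apply, smul_eq_mul]
          rw [hS (fderiv ℝ v x (e k)) (fderiv ℝ v x (e l))]
          by_cases hlj : l = j <;> by_cases hlk : l = k
          · exact absurd (hlj.symm.trans hlk) hjk
          · subst hlj; simp [he, hlk]; ring
          · subst hlk; simp [he, hjk, hlj]; ring
          · simp [he, hlj, hlk, hjk, Ne.symm hlj]; ring
        simp only [h₂, Finset.sum_add_distrib, Finset.sum_sub_distrib, ← Finset.mul_sum, ← h₁]
        simp
        ring
    _ = 0 := by
        rw [integral_finsetSum]
        swap
        · exact fun l _ ↦ (hint l _ _).sub (hint l _ _)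
        refine Finset.sum_eq_zero fun l _ ↦ ?_
        rw [integral_sub (hint l _ _) (hint l _ _),
          integral_bilin_fderiv_fderiv_comm _ S (hu l) (huc l) hv hvc, sub_self]

end Euler

section Clifford

open Filter Topology

variable {n : ℕ} {F : Type*} [NormedAddCommGroup F] [NormedSpace ℝ F]

/-- Clifford multiplication by the vector `x`. -/
noncomputable def cliffordMul (g : Fin n → F →L[ℝ] F) (x : EuclideanSpace ℝ (Fin n)) :
    F →L[ℝ] F :=
  ∑ j, x j • g j

/-- The Dirac operator `∑ j, g j (∂_j v)` of a family of operators `g`. -/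
noncomputable def cliffordDirac (g : Fin n → F →L[ℝ] F) (v : EuclideanSpace ℝ (Fin n) → F)
    (x : EuclideanSpace ℝ (Fin n)) : F :=
  ∑ j, g j (fderiv ℝ v x (EuclideanSpace.single j 1))

/-- The angular part `∑_{j ≠ k} x_j g_j g_k ∂_k v` of `x · D v`. -/
noncomputable def cliffordAngular (g : Fin n → F →L[ℝ] F) (v : EuclideanSpace ℝ (Fin n) → F)
    (x : EuclideanSpace ℝ (Fin n)) : F :=
  ∑ j, ∑ k, if j = k then 0 else x j • g j (g k (fderiv ℝ v x (EuclideanSpace.single k 1)))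

theorem cliffordMul_apply (g : Fin n → F →L[ℝ] F) (x : EuclideanSpace ℝ (Fin n)) (z : F) :
    cliffordMul g x z = ∑ j, x j • g j z := by
  simp [cliffordMul]

variable {g : Fin n → F →L[ℝ] F} {h : F →L[ℝ] F →L[ℝ] ℝ}
  {v : EuclideanSpace ℝ (Fin n) → F}

theorem clifford_apply_self
    (hg : ∀ i j z, g i (g j z) + g j (g i z) = if i = j then (-2 : ℝ) • z else 0) (j : Fin n)
    (z : F) : g j (g j z) = -z := by
  have := hg j j z
  rw [if_pos rfl, ← two_smul ℝ] at this
  refine smul_right_injective F (two_ne_zero (α := ℝ)) ?_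
  simpa using this

theorem clifford_apply_of_ne
    (hg : ∀ i j z, g i (g j z) + g j (g i z) = if i = j then (-2 : ℝ) • z else 0) {i j : Fin n}
    (hij : i ≠ j) (z : F) : g i (g j z) = - g j (g i z) := by
  have := hg i j z
  rw [if_neg hij] at this
  exact eq_neg_of_add_eq_zero_left this

theorem cliffordMul_cliffordMul
    (hg : ∀ i j z, g i (g j z) + g j (g i z) = if i = j then (-2 : ℝ) • z else 0)
    (x : EuclideanSpace ℝ (Fin n)) (z : F) :
    cliffordMul g x (cliffordMul g x z) = -(‖x‖ ^ 2 • z) := by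
  have h₁ : cliffordMul g x (cliffordMul g x z) = ∑ i, ∑ j, (x i * x j) • g i (g j z) := by
    rw [cliffordMul_apply g x (cliffordMul g x z), cliffordMul_apply]
    simp [Finset.smul_sum, smul_smul]
  have h₂ : cliffordMul g x (cliffordMul g x z) = ∑ i, ∑ j, (x i * x j) • g j (g i z) := by
    rw [h₁, Finset.sum_comm]
    refine Finset.sum_congr rfl fun i _ ↦ Finset.sum_congr rfl fun j _ ↦ ?_
    rw [mul_comm]
  have h₃ : (2 : ℝ) • cliffordMul g x (cliffordMul g x z) = (2 : ℝ) • -(‖x‖ ^ 2 • z) := by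
    rw [two_smul]
    nth_rewrite 1 [h₁]
    rw [h₂]
    simp only [← Finset.sum_add_distrib, ← smul_add, hg, smul_ite, smul_zero,
      Finset.sum_ite_eq, Finset.mem_univ, if_true, smul_smul]
    rw [← Finset.sum_smul, EuclideanSpace.real_norm_sq_eq, ← Finset.sum_mul]
    simp only [← sq]
    module
  exact smul_right_injective F (two_ne_zero (α := ℝ)) h₃

theorem cliffordMul_skew (hgh : ∀ j u v, h (g j u) v = - h u (g j v))
    (x : EuclideanSpace ℝ (Fin n)) (u v : F) :
    h (cliffordMul g x u) v = - h u (cliffordMul g x v) := by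
  simp [cliffordMul_apply, hgh, sum_apply]

theorem cliffordMul_isometry
    (hg : ∀ i j z, g i (g j z) + g j (g i z) = if i = j then (-2 : ℝ) • z else 0)
    (hgh : ∀ j u v, h (g j u) v = - h u (g j v))
    (x : EuclideanSpace ℝ (Fin n)) (u : F) :
    h (cliffordMul g x u) (cliffordMul g x u) = ‖x‖ ^ 2 * h u u := by
  rw [cliffordMul_skew hgh, cliffordMul_cliffordMul hg]
  simp

theorem cliffordMul_cliffordDirac
    (hg : ∀ i j z, g i (g j z) + g j (g i z) = if i = j then (-2 : ℝ) • z else 0)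
    (x : EuclideanSpace ℝ (Fin n)) :
    cliffordMul g x (cliffordDirac g v x) = cliffordAngular g v x - fderiv ℝ v x x := by
  rw [ContinuousLinearMap.apply_eq_sum_single (fderiv ℝ v x) x, cliffordAngular,
    ← Finset.sum_sub_distrib, cliffordMul_apply]
  refine Finset.sum_congr rfl fun j _ ↦ ?_
  have hdiag : x j • fderiv ℝ v x (EuclideanSpace.single j 1)
      = ∑ k, if j = k then x j • fderiv ℝ v x (EuclideanSpace.single k 1) else 0 := by
    simp
  rw [cliffordDirac, map_sum, Finset.smul_sum, hdiag, ← Finset.sum_sub_distrib]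
  refine Finset.sum_congr rfl fun k _ ↦ ?_
  by_cases hjk : j = k
  · subst hjk
    simp [clifford_apply_self hg]
  · simp [hjk]

theorem continuous_cliffordDirac (hv : ContDiff ℝ 1 v) : Continuous (cliffordDirac g v) := by
  have hcv (d : EuclideanSpace ℝ (Fin n)) : Continuous fun x ↦ fderiv ℝ v x d :=
    (hv.continuous_fderiv one_ne_zero).clm_apply continuous_const
  unfold cliffordDirac
  fun_prop

theorem integral_euler_angular_eq_zero
    (hg : ∀ i j z, g i (g j z) + g j (g i z) = if i = j then (-2 : ℝ) • z else 0)
    (hgh : ∀ j u v, h (g j u) v = - h u (g j v)) (hsymm : ∀ u v, h u v = h v u)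
    (hv : ContDiff ℝ 1 v) (hvc : HasCompactSupport v) :
    Integrable (fun x ↦ h ((2 : ℝ) • fderiv ℝ v x x + (n : ℝ) • v x) (cliffordAngular g v x)) ∧
    ∫ x, h ((2 : ℝ) • fderiv ℝ v x x + (n : ℝ) • v x) (cliffordAngular g v x) = 0 := by
  have hcv (d : EuclideanSpace ℝ (Fin n)) : Continuous fun x ↦ fderiv ℝ v x d :=
    (hv.continuous_fderiv one_ne_zero).clm_apply continuous_const
  have hcx : Continuous fun x ↦ fderiv ℝ v x x :=
    (hv.continuous_fderiv one_ne_zero).clm_apply continuous_id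
  have hcv₀ := hv.continuous
  let S (j k : Fin n) : F →L[ℝ] F →L[ℝ] ℝ :=
    h.bilinearComp (ContinuousLinearMap.id ℝ F) (g j ∘L g k)
  have hS (j k : Fin n) (u v : F) : S j k u v = h u (g j (g k v)) := by simp [S]
  let f (j k : Fin n) (x : EuclideanSpace ℝ (Fin n)) : ℝ :=
    if j = k then 0 else x j * S j k ((2 : ℝ) • fderiv ℝ v x x + (n : ℝ) • v x)
      (fderiv ℝ v x (EuclideanSpace.single k 1))
  have heq : (fun x ↦ h ((2 : ℝ) • fderiv ℝ v x x + (n : ℝ) • v x) (cliffordAngular g v x))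
      = fun x ↦ ∑ j, ∑ k, f j k x := by
    funext x
    simp only [cliffordAngular, map_sum, f, hS]
    refine Finset.sum_congr rfl fun j _ ↦ Finset.sum_congr rfl fun k _ ↦ ?_
    split_ifs
    · exact map_zero _
    · rw [map_smul, smul_eq_mul]
  have hf (j k : Fin n) : Integrable (f j k) ∧ ∫ x, f j k x = 0 := by
    by_cases hjk : j = k
    · simp [f, hjk]
    · simp only [f, if_neg hjk]
      constructor
      · refine Continuous.integrable_of_hasCompactSupport (by fun_prop) ?_
        exact ((hvc.fderiv_apply ℝ (EuclideanSpace.single k 1)).bilin_right (S j k)).mul_left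
      · refine integral_skew_euler_eq_zero (S j k) (fun u w ↦ ?_) hv hvc hjk
        rw [hS, hS, hsymm w, clifford_apply_of_ne hg hjk, map_neg, hgh, hgh, neg_neg]
  have hint (j : Fin n) : Integrable fun x ↦ ∑ k, f j k x :=
    integrable_finsetSum _ fun k _ ↦ (hf j k).1
  rw [heq]
  refine ⟨integrable_finsetSum _ fun j _ ↦ hint j, ?_⟩
  rw [integral_finsetSum _ fun j _ ↦ hint j]
  refine Finset.sum_eq_zero fun j _ ↦ ?_
  rw [integral_finsetSum _ fun k _ ↦ (hf j k).1]
  exact Finset.sum_eq_zero fun k _ ↦ (hf j k).2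

theorem ContDiff.smul_of_eventuallyEq_zero {X : Type*} [NormedAddCommGroup X] [NormedSpace ℝ X]
    {f : X → ℝ} {w : X → F} (hf : ∀ x ≠ 0, ContDiffAt ℝ 1 f x) (hw : ContDiff ℝ 1 w)
    (h0 : w =ᶠ[𝓝 0] 0) : ContDiff ℝ 1 fun x ↦ f x • w x := by
  refine contDiff_iff_contDiffAt.2 fun x ↦ ?_
  by_cases hx : x = 0
  · subst hx
    refine (contDiffAt_const (c := (0 : F))).congr_of_eventuallyEq ?_
    filter_upwards [h0] with y hy
    simp [hy]
  · exact (hf x hx).smul hw.contDiffAt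

theorem hasFDerivAt_div_norm_sq {X : Type*} [NormedAddCommGroup X] [InnerProductSpace ℝ X]
    (a : ℝ) {x : X} (hx : x ≠ 0) :
    HasFDerivAt (fun y : X ↦ a / ‖y‖ ^ 2) (-(2 * a / ‖x‖ ^ 4) • innerSL ℝ x) x := by
  have hn : ‖x‖ ≠ 0 := norm_ne_zero_iff.2 hx
  have h₁ := (hasStrictFDerivAt_norm_sq x).hasFDerivAt
  have h₂ := ((hasDerivAt_inv (pow_ne_zero 2 hn)).const_mul a).comp_hasFDerivAt x h₁
  refine (h₂.congr_fderiv ?_)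
  ext y
  simp
  field_simp

theorem contDiffAt_div_norm_sq {X : Type*} [NormedAddCommGroup X] [InnerProductSpace ℝ X]
    (a : ℝ) {x : X} (hx : x ≠ 0) : ContDiffAt ℝ 1 (fun y : X ↦ a / ‖y‖ ^ 2) x :=
  contDiffAt_const.div (contDiff_norm_sq ℝ).contDiffAt (pow_ne_zero 2 (norm_ne_zero_iff.2 hx))

theorem bilin_add_self_ge (hsymm : ∀ u v, h u v = h v u) (hpos : ∀ u, 0 ≤ h u u) (a b : F) :
    4 * h a b ≤ h (a + b) (a + b) := by
  have h₁ := hpos (a - b)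
  have h₂ := hsymm b a
  simp only [map_add, map_sub, add_apply, sub_apply] at *
  linarith

/-- The pointwise Carleman inequality: up to two terms of integral zero, the weighted square of
`D w` controls the weighted square of `w`. -/
theorem carleman_pointwise
    (hg : ∀ i j z, g i (g j z) + g j (g i z) = if i = j then (-2 : ℝ) • z else 0)
    (hgh : ∀ j u v, h (g j u) v = - h u (g j v)) (hsymm : ∀ u v, h u v = h v u)
    (hpos : ∀ u, 0 ≤ h u u) {w : EuclideanSpace ℝ (Fin n) → F} (hw : ContDiff ℝ 1 w)
    (τ : ℝ) {ρ κ G : EuclideanSpace ℝ (Fin n) → ℝ}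
    (hρ : ρ = fun x ↦ Real.exp (τ / ‖x‖ ^ 2)) (hv : v = fun x ↦ ρ x • w x)
    (hκ : κ = fun x ↦ 2 * τ / ‖x‖ ^ 2 - n / 2) (hG : G = fun x ↦ κ x • h (v x) (v x))
    {x : EuclideanSpace ℝ (Fin n)} (hx : x ≠ 0) :
    8 * τ / ‖x‖ ^ 2 * h (v x) (v x) + 2 * (fderiv ℝ G x x + n * G x)
      - 2 * h ((2 : ℝ) • fderiv ℝ v x x + (n : ℝ) • v x) (cliffordAngular g v x)
      ≤ ρ x ^ 2 * ‖x‖ ^ 2 * h (cliffordDirac g w x) (cliffordDirac g w x) := by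
  have hn : ‖x‖ ≠ 0 := norm_ne_zero_iff.2 hx
  have hρ' : HasFDerivAt ρ (ρ x • (-(2 * τ / ‖x‖ ^ 4) • innerSL ℝ x)) x := by
    rw [hρ]
    exact (hasFDerivAt_div_norm_sq τ hx).exp
  have hκ' : HasFDerivAt κ (-(2 * (2 * τ) / ‖x‖ ^ 4) • innerSL ℝ x) x := by
    rw [hκ]
    exact (hasFDerivAt_div_norm_sq (2 * τ) hx).sub_const _
  have hw' := (hw.differentiable one_ne_zero x).hasFDerivAt
  have hv' := hρ'.smul hw'
  change HasFDerivAt (fun x ↦ ρ x • w x) _ x at hv'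
  rw [← hv] at hv'
  have hvd (d : EuclideanSpace ℝ (Fin n)) : fderiv ℝ v x d
      = ρ x • fderiv ℝ w x d - (2 * τ / ‖x‖ ^ 4 * inner ℝ x d) • v x := by
    rw [hv'.fderiv, hv]
    simp [smul_smul]
    module
  have hGx : fderiv ℝ G x x = -(4 * τ / ‖x‖ ^ 2) * h (v x) (v x)
      + 2 * (κ x * h (fderiv ℝ v x x) (v x)) := by
    have hvv := hv'.differentiableAt.hasFDerivAt
    have hG' := hκ'.smul (h.hasFDerivAt_of_bilinear hvv hvv)
    change HasFDerivAt (fun x ↦ κ x • h (v x) (v x)) _ x at hG'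
    rw [← hG] at hG'
    rw [hG'.fderiv]
    simp [hsymm (v x) (fderiv ℝ v x x)]
    field_simp
    ring
  have hDv : cliffordDirac g v x
      = ρ x • cliffordDirac g w x - (2 * τ / ‖x‖ ^ 4) • cliffordMul g x (v x) := by
    simp only [cliffordDirac, hvd, cliffordMul_apply, map_sub, map_smul, Finset.sum_sub_distrib,
      Finset.smul_sum, smul_smul]
    simp [EuclideanSpace.inner_single_right]
  have hxD : ρ x • cliffordMul g x (cliffordDirac g w x)
      = -(((1 / 2 : ℝ) • ((2 : ℝ) • fderiv ℝ v x x + (n : ℝ) • v x))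
        + (κ x • v x - cliffordAngular g v x)) := by
    have h₁ := cliffordMul_cliffordDirac (v := v) hg x
    rw [hDv, map_sub, map_smul, map_smul, cliffordMul_cliffordMul hg, smul_neg, smul_smul] at h₁
    have h₂ : 2 * τ / ‖x‖ ^ 4 * ‖x‖ ^ 2 = κ x + n / 2 := by
      rw [hκ]
      field_simp
      ring
    rw [h₂] at h₁
    rw [sub_eq_iff_eq_add.1 h₁]
    module
  have hsq : ρ x ^ 2 * ‖x‖ ^ 2 * h (cliffordDirac g w x) (cliffordDirac g w x)
      = h (ρ x • cliffordMul g x (cliffordDirac g w x))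
        (ρ x • cliffordMul g x (cliffordDirac g w x)) := by
    simp only [map_smul, smul_apply, cliffordMul_isometry hg hgh, smul_eq_mul]
    ring
  rw [hsq, hxD, map_neg, map_neg, neg_apply, neg_neg, hGx]
  refine le_trans (le_of_eq ?_) (bilin_add_self_ge hsymm hpos _ _)
  rw [hG]
  simp only [map_add, map_sub, map_smul, add_apply, smul_apply, smul_eq_mul]
  ring

theorem carleman_integral
    (hg : ∀ i j z, g i (g j z) + g j (g i z) = if i = j then (-2 : ℝ) • z else 0)
    (hgh : ∀ j u v, h (g j u) v = - h u (g j v)) (hsymm : ∀ u v, h u v = h v u)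
    (hpos : ∀ u, 0 ≤ h u u) {w : EuclideanSpace ℝ (Fin n) → F} (hw : ContDiff ℝ 1 w)
    (hws : ∀ x, 1 < ‖x‖ → w x = 0) (hwc : HasCompactSupport w) (h0 : w =ᶠ[𝓝 0] 0)
    {τ : ℝ} (hτ : 0 ≤ τ) {ρ : EuclideanSpace ℝ (Fin n) → ℝ}
    (hρ : ρ = fun x ↦ Real.exp (τ / ‖x‖ ^ 2)) (hv : v = fun x ↦ ρ x • w x)
    {f : EuclideanSpace ℝ (Fin n) → ℝ} (hf : Integrable f)
    (hfρ : ∀ x, ρ x ^ 2 * ‖x‖ ^ 2 * h (cliffordDirac g w x) (cliffordDirac g w x) ≤ f x) :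
    8 * τ * ∫ x, h (v x) (v x) ≤ ∫ x, f x := by
  have hv1 : ContDiff ℝ 1 v := by
    rw [hv, hρ]
    exact hw.smul_of_eventuallyEq_zero (fun x hx ↦ (contDiffAt_div_norm_sq τ hx).exp) h0
  have hv0 : v =ᶠ[𝓝 0] 0 := by
    filter_upwards [h0] with x hx
    simp [hv, hx]
  have hvc : HasCompactSupport v := by
    rw [hv]
    exact hwc.smul_left
  have hvv : ContDiff ℝ 1 fun x ↦ h (v x) (v x) :=
    h.isBoundedBilinearMap.contDiff.comp (hv1.prodMk hv1)
  have hvv0 : (fun x ↦ h (v x) (v x)) =ᶠ[𝓝 0] 0 := by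
    filter_upwards [hv0] with x hx
    simp [hx]
  obtain ⟨κ, hκ⟩ : ∃ κ : EuclideanSpace ℝ (Fin n) → ℝ,
    κ = fun x ↦ 2 * τ / ‖x‖ ^ 2 - n / 2 := ⟨_, rfl⟩
  obtain ⟨G, hGdef⟩ : ∃ G : EuclideanSpace ℝ (Fin n) → ℝ,
    G = fun x ↦ κ x • h (v x) (v x) := ⟨_, rfl⟩
  have hG : ContDiff ℝ 1 G := by
    rw [hGdef, hκ]
    exact ContDiff.smul_of_eventuallyEq_zero
      (fun x hx ↦ (contDiffAt_div_norm_sq (2 * τ) hx).sub contDiffAt_const) hvv hvv0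
  have hGc : HasCompactSupport G := by
    rw [hGdef]
    exact (hvc.bilin_left h).smul_left (f := κ)
  obtain ⟨hAi, hA⟩ := integral_euler_angular_eq_zero hg hgh hsymm hv1 hvc
  have hE := integral_euler_add_eq_zero hG hGc
  have hEi : Integrable fun x ↦ fderiv ℝ G x x + n * G x := by
    have h₁ : Continuous fun x ↦ fderiv ℝ G x x :=
      (hG.continuous_fderiv one_ne_zero).clm_apply continuous_id
    refine (h₁.integrable_of_hasCompactSupport ?_).add
      ((hG.continuous.integrable_of_hasCompactSupport hGc).const_mul _)
    exact (hGc.fderiv ℝ).mono fun x hx hx' ↦ hx (by simp [hx'])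
  have hvi : Integrable fun x ↦ h (v x) (v x) :=
    hvv.continuous.integrable_of_hasCompactSupport (hvc.bilin_left h)
  have hpt (x : EuclideanSpace ℝ (Fin n)) : 8 * τ * h (v x) (v x)
      + 2 * (fderiv ℝ G x x + n * G x)
      - 2 * h ((2 : ℝ) • fderiv ℝ v x x + (n : ℝ) • v x) (cliffordAngular g v x) ≤ f x := by
    refine le_trans ?_ (hfρ x)
    by_cases hx : x = 0
    · subst hx
      simp [hv0.eq_of_nhds, hGdef]
    have hn : 0 < ‖x‖ := norm_pos_iff.2 hx
    refine le_trans ?_ (carleman_pointwise hg hgh hsymm hpos hw τ hρ hv hκ hGdef hx)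
    have hle : 8 * τ * h (v x) (v x) ≤ 8 * τ / ‖x‖ ^ 2 * h (v x) (v x) := by
      rcases le_or_gt ‖x‖ 1 with h1 | h1
      · refine mul_le_mul_of_nonneg_right ?_ (hpos _)
        exact le_div_self (by positivity) (by positivity) (pow_le_one₀ hn.le h1)
      · simp [hv, hws x h1]
    linarith
  have hi₁ := hvi.const_mul (8 * τ)
  have hi₂ := hEi.const_mul 2
  have hi₃ := hAi.const_mul 2
  have hi₁₂ : Integrable fun x ↦
    8 * τ * h (v x) (v x) + 2 * (fderiv ℝ G x x + n * G x) := hi₁.add hi₂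
  have hint := integral_mono (hi₁₂.sub hi₃) hf hpt
  rw [integral_sub' hi₁₂ hi₃, integral_add hi₁ hi₂, integral_const_mul, integral_const_mul,
    integral_const_mul, hE, hA] at hint
  simpa using hint

theorem eqOn_zero_of_cliffordDirac_le
    (hg : ∀ i j z, g i (g j z) + g j (g i z) = if i = j then (-2 : ℝ) • z else 0)
    (hgh : ∀ j u v, h (g j u) v = - h u (g j v)) (hsymm : ∀ u v, h u v = h v u)
    (hpos : ∀ u, ‖u‖ ^ 2 ≤ h u u) {w : EuclideanSpace ℝ (Fin n) → F} (hw : ContDiff ℝ 1 w)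
    (hws : ∀ x, 1 < ‖x‖ → w x = 0) (h0 : w =ᶠ[𝓝 0] 0) {M R : ℝ} (hM0 : 0 ≤ M)
    (hM : ∀ x ∈ Metric.ball (0 : EuclideanSpace ℝ (Fin n)) R,
      h (cliffordDirac g w x) (cliffordDirac g w x) ≤ M * h (w x) (w x)) :
    ∀ x ∈ Metric.ball (0 : EuclideanSpace ℝ (Fin n)) R, w x = 0 := by
  have hpos' (u : F) : 0 ≤ h u u := (sq_nonneg _).trans (hpos u)
  have hhc : Continuous fun u : F × F ↦ h u.1 u.2 := by fun_prop
  have hwc : HasCompactSupport w := by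
    refine HasCompactSupport.intro (isCompact_closedBall (0 : EuclideanSpace ℝ (Fin n)) 1)
      fun x hx ↦ hws x ?_
    simpa using hx
  have hDc := continuous_cliffordDirac (g := g) hw
  have hD0 (x : EuclideanSpace ℝ (Fin n)) (hx : 1 < ‖x‖) : cliffordDirac g w x = 0 := by
    have : w =ᶠ[𝓝 x] 0 := by
      filter_upwards [continuous_norm.continuousAt.eventually (lt_mem_nhds hx)] with y hy
      exact hws y hy
    simp [cliffordDirac, this.fderiv_eq]
  obtain ⟨P, hP⟩ : ∃ P : EuclideanSpace ℝ (Fin n) → ℝ, P = fun x ↦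
    h (cliffordDirac g w x) (cliffordDirac g w x) := ⟨_, rfl⟩
  have hPi : Integrable P := by
    rw [hP]
    refine (hhc.comp (hDc.prodMk hDc)).integrable_of_hasCompactSupport
      (HasCompactSupport.intro (isCompact_closedBall (0 : EuclideanSpace ℝ (Fin n)) 1)
      fun x hx ↦ ?_)
    have : cliffordDirac g w x = 0 := hD0 x (by simpa using hx)
    simp [this]
  have hP0 (x : EuclideanSpace ℝ (Fin n)) : 0 ≤ P x := by
    rw [hP]
    exact hpos' _
  have hPle (x : EuclideanSpace ℝ (Fin n)) : ‖x‖ ^ 2 * P x ≤ P x := by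
    rcases le_or_gt ‖x‖ 1 with h1 | h1
    · exact mul_le_of_le_one_left (hP0 x) (pow_le_one₀ (norm_nonneg x) h1)
    · simp [hP, hD0 x h1]
  obtain ⟨Q, hQ⟩ : ∃ Q : EuclideanSpace ℝ (Fin n) → ℝ, Q = fun x ↦ h (w x) (w x) := ⟨_, rfl⟩
  have hQc : Continuous Q := by
    rw [hQ]
    exact hhc.comp (hw.continuous.prodMk hw.continuous)
  have hQ0 (x : EuclideanSpace ℝ (Fin n)) : 0 ≤ Q x := by
    rw [hQ]
    exact hpos' _
  have hQi : Integrable Q :=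
    hQc.integrable_of_hasCompactSupport (by rw [hQ]; exact hwc.bilin_left h)
  rcases le_or_gt R 0 with hR | hR
  · simp [Metric.ball_eq_empty.2 hR]
  have main (τ : ℝ) (hτ : 0 ≤ τ) (hτM : M ≤ 8 * τ) :
      (8 * τ - M) * ∫ x in Metric.ball (0 : EuclideanSpace ℝ (Fin n)) R, Q x ≤ ∫ x, P x := by
    obtain ⟨ρ, hρ⟩ : ∃ ρ : EuclideanSpace ℝ (Fin n) → ℝ,
      ρ = fun x ↦ Real.exp (τ / ‖x‖ ^ 2) := ⟨_, rfl⟩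
    obtain ⟨v, hv⟩ : ∃ v : EuclideanSpace ℝ (Fin n) → F, v = fun x ↦ ρ x • w x := ⟨_, rfl⟩
    have hvQ (x : EuclideanSpace ℝ (Fin n)) : h (v x) (v x) = ρ x ^ 2 * Q x := by
      simp only [hv, hQ, map_smul, smul_apply, smul_eq_mul]
      ring
    set c := Real.exp (τ / R ^ 2) ^ 2 with hc
    have hcpos : 0 < c := by positivity
    have hvc : Continuous v := by
      rw [hv, hρ]
      exact (hw.smul_of_eventuallyEq_zero
        (fun x hx ↦ (contDiffAt_div_norm_sq τ hx).exp) h0).continuous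
    have hvi : Integrable fun x ↦ h (v x) (v x) :=
      (hhc.comp (hvc.prodMk hvc)).integrable_of_hasCompactSupport
        (HasCompactSupport.bilin_left h (by rw [hv]; exact hwc.smul_left))
    have hcar := carleman_integral hg hgh hsymm hpos' hw hws hwc h0 hτ hρ hv
      (f := fun x ↦ M * h (v x) (v x) + c * P x) ((hvi.const_mul M).add (hPi.const_mul c))
      fun x ↦ by
        rw [← congrFun hP x, mul_assoc, hvQ]
        rcases lt_or_ge ‖x‖ R with hxR | hxR
        · have h₁ : P x ≤ M * Q x := by
            rw [hP, hQ]
            exact hM x (by simpa using hxR)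
          have h₂ := mul_le_mul_of_nonneg_left ((hPle x).trans h₁) (sq_nonneg (ρ x))
          have h₃ := mul_nonneg hcpos.le (hP0 x)
          linarith
        · have h₁ : ρ x ^ 2 ≤ c := by
            simp only [hc, hρ]
            gcongr
          have h₂ := mul_le_mul h₁ (hPle x) (mul_nonneg (sq_nonneg _) (hP0 x)) hcpos.le
          have h₃ := mul_nonneg hM0 (mul_nonneg (sq_nonneg (ρ x)) (hQ0 x))
          linarith
    rw [integral_add (hvi.const_mul M) (hPi.const_mul c), integral_const_mul,
      integral_const_mul] at hcar
    have hlow : c * ∫ x in Metric.ball (0 : EuclideanSpace ℝ (Fin n)) R, Q x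
        ≤ ∫ x, h (v x) (v x) := by
      rw [← integral_const_mul]
      refine le_trans (setIntegral_mono_on (hQi.const_mul c).integrableOn hvi.integrableOn
        measurableSet_ball fun x hx ↦ ?_)
        (setIntegral_le_integral hvi (.of_forall fun x ↦ hpos' _))
      rw [hvQ]
      by_cases hx0 : x = 0
      · subst hx0
        simp [hQ, h0.eq_of_nhds]
      · have hn : 0 < ‖x‖ := norm_pos_iff.2 hx0
        refine mul_le_mul_of_nonneg_right ?_ (hQ0 x)
        have hxR : ‖x‖ < R := by simpa using hx
        simp only [hc, hρ]
        gcongr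
    have h₁ : (8 * τ - M) * (c * ∫ x in Metric.ball (0 : EuclideanSpace ℝ (Fin n)) R, Q x)
        ≤ c * ∫ x, P x :=
      (mul_le_mul_of_nonneg_left hlow (by linarith)).trans (by linarith)
    refine le_of_mul_le_mul_left ?_ hcpos
    linarith
  have hzero : ∫ x in Metric.ball (0 : EuclideanSpace ℝ (Fin n)) R, Q x = 0 := by
    refine le_antisymm ?_ (integral_nonneg hQ0)
    by_contra! hI
    set I := ∫ x in Metric.ball (0 : EuclideanSpace ℝ (Fin n)) R, Q x
    have hP0' : 0 ≤ ∫ x, P x := integral_nonneg hP0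
    have := main ((M + (∫ x, P x) / I + 1) / 8) (by positivity) (by
      have : 0 ≤ (∫ x, P x) / I := by positivity
      linarith)
    have h₂ : (∫ x, P x) / I * I = ∫ x, P x := div_mul_cancel₀ _ hI.ne'
    nlinarith
  have hae := (setIntegral_eq_zero_iff_of_nonneg_ae (.of_forall hQ0) hQi.integrableOn).1 hzero
  have heq := Measure.eqOn_open_of_ae_eq hae Metric.isOpen_ball hQc.continuousOn
    continuousOn_const
  intro x hx
  have h₁ : h (w x) (w x) = 0 := by
    have := heq hx
    rwa [hQ] at this
  have h₂ := hpos (w x)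
  rw [h₁] at h₂
  simpa using h₂.antisymm (sq_nonneg _)

end Clifford

section InvariantForm

variable {n : ℕ} {F : Type*} [NormedAddCommGroup F] [NormedSpace ℝ F]

/-- Averaging makes a family of Clifford generators skew for a positive definite form. -/
theorem exists_bilin_skew_clifford {g : Fin n → F →L[ℝ] F}
    (hg : ∀ i j z, g i (g j z) + g j (g i z) = if i = j then (-2 : ℝ) • z else 0)
    {h₀ : F →L[ℝ] F →L[ℝ] ℝ} (hsymm : ∀ u v, h₀ u v = h₀ v u) (hpos : ∀ u, ‖u‖ ^ 2 ≤ h₀ u u) :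
    ∃ h : F →L[ℝ] F →L[ℝ] ℝ, (∀ u v, h u v = h v u) ∧ (∀ u, ‖u‖ ^ 2 ≤ h u u) ∧
      ∀ j u v, h (g j u) v = - h u (g j v) := by
  have key (s : Finset (Fin n)) : ∃ h : F →L[ℝ] F →L[ℝ] ℝ, (∀ u v, h u v = h v u) ∧
      (∀ u, ‖u‖ ^ 2 ≤ h u u) ∧ ∀ j ∈ s, ∀ u v, h (g j u) (g j v) = h u v := by
    induction s using Finset.induction_on with
    | empty => exact ⟨h₀, hsymm, hpos, by simp⟩
    | insert i s his ih =>
      obtain ⟨h, h₁, h₂, h₃⟩ := ih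
      refine ⟨h + h.bilinearComp (g i) (g i), fun u v ↦ ?_, fun u ↦ ?_, fun j hj u v ↦ ?_⟩
      · simp [h₁ u v, h₁ (g i u)]
      · have h₄ := (sq_nonneg _).trans (h₂ (g i u))
        have h₅ := h₂ u
        simp only [add_apply, ContinuousLinearMap.bilinearComp_apply]
        linarith
      · simp only [add_apply, ContinuousLinearMap.bilinearComp_apply]
        rcases eq_or_ne j i with rfl | hji
        · simp [clifford_apply_self hg, add_comm]
        · have hjs := (Finset.mem_insert.1 hj).resolve_left hji
          simp [clifford_apply_of_ne hg hji.symm, h₃ j hjs]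
  obtain ⟨h, h₁, h₂, h₃⟩ := key Finset.univ
  refine ⟨h, h₁, h₂, fun j u v ↦ ?_⟩
  rw [← h₃ j (Finset.mem_univ j) (g j u) v, clifford_apply_self hg]
  simp

end InvariantForm

/-- The real part of the inner product of `ℂ^N`, as a real bilinear form. -/
noncomputable def reInnerForm (N : ℕ) :
    EuclideanSpace ℂ (Fin N) →L[ℝ] EuclideanSpace ℂ (Fin N) →L[ℝ] ℝ :=
  LinearMap.mkContinuous₂
    (LinearMap.mk₂ ℝ (fun u v : EuclideanSpace ℂ (Fin N) ↦ (inner ℂ u v).re)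
      (fun u u' v ↦ by rw [inner_add_left, Complex.add_re])
      (fun c u v ↦ by rw [← Complex.coe_smul, inner_smul_left]; simp)
      (fun u v v' ↦ by rw [inner_add_right, Complex.add_re])
      (fun c u v ↦ by rw [← Complex.coe_smul, inner_smul_right]; simp))
    1 (fun u v ↦ by
      rw [one_mul]
      exact (Complex.abs_re_le_norm _).trans (norm_inner_le_norm u v))

theorem reInnerForm_apply {N : ℕ} (u v : EuclideanSpace ℂ (Fin N)) :
    reInnerForm N u v = (inner ℂ u v).re := rfl

/-- A complex matrix as a real-linear operator of `ℂ^N`. -/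
noncomputable def matrixOp {N : ℕ} (A : Matrix (Fin N) (Fin N) ℂ) :
    EuclideanSpace ℂ (Fin N) →L[ℝ] EuclideanSpace ℂ (Fin N) :=
  (Matrix.toEuclideanCLM (𝕜 := ℂ) A).restrictScalars ℝ

theorem matrixOp_apply {N : ℕ} (A : Matrix (Fin N) (Fin N) ℂ) (z : EuclideanSpace ℂ (Fin N)) :
    matrixOp A z = WithLp.toLp 2 (A.mulVec z.ofLp) := rfl

theorem dirac_eq_cliffordDirac {n N : ℕ} (γ : Fin n → Matrix (Fin N) (Fin N) ℂ)
    (φ : EuclideanSpace ℝ (Fin n) → EuclideanSpace ℂ (Fin N)) (x : EuclideanSpace ℝ (Fin n)) :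
    dirac γ φ x = cliffordDirac (fun j ↦ matrixOp (γ j)) φ x := by
  simp only [dirac, cliffordDirac, matrixOp_apply]
  rw [← WithLp.toLp_sum]
  rfl

theorem matrixOp_clifford {n N : ℕ} {γ : Fin n → Matrix (Fin N) (Fin N) ℂ}
    (hγ : ∀ i j, γ i * γ j + γ j * γ i = if i = j then (-2 : ℂ) • 1 else 0)
    (i j : Fin n) (z : EuclideanSpace ℂ (Fin N)) :
    matrixOp (γ i) (matrixOp (γ j) z) + matrixOp (γ j) (matrixOp (γ i) z)
      = if i = j then (-2 : ℝ) • z else 0 := by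
  simp only [matrixOp_apply, Matrix.mulVec_mulVec]
  rw [← WithLp.toLp_add, ← Matrix.add_mulVec, hγ]
  split_ifs
  · ext k
    simp [Matrix.neg_mulVec, Matrix.smul_mulVec]
  · simp

section Local

open Filter Topology

variable {n : ℕ} {F : Type*} [NormedAddCommGroup F] [NormedSpace ℝ F]
  {g : Fin n → F →L[ℝ] F} {h : F →L[ℝ] F →L[ℝ] ℝ} {φ : EuclideanSpace ℝ (Fin n) → F}

theorem eqOn_ball_zero_of_cliffordDirac_le
    (hg : ∀ i j z, g i (g j z) + g j (g i z) = if i = j then (-2 : ℝ) • z else 0)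
    (hgh : ∀ j u v, h (g j u) v = - h u (g j v)) (hsymm : ∀ u v, h u v = h v u)
    (hpos : ∀ u, ‖u‖ ^ 2 ≤ h u u) {y : EuclideanSpace ℝ (Fin n)} {δ K : ℝ} (hδ : 0 < δ)
    (hδ1 : δ ≤ 1) (hφ : ∀ x ∈ Metric.closedBall y δ, ContDiffAt ℝ 1 φ x)
    (hy : φ =ᶠ[𝓝 y] 0)
    (hK : ∀ x ∈ Metric.ball y (δ / 2), ‖cliffordDirac g φ x‖ ≤ K * ‖φ x‖) :
    ∀ x ∈ Metric.ball y (δ / 2), φ x = 0 := by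
  let χ : ContDiffBump (0 : EuclideanSpace ℝ (Fin n)) := ⟨δ / 2, δ, by positivity, by linarith⟩
  let w : EuclideanSpace ℝ (Fin n) → F := fun x ↦ χ x • φ (x + y)
  have hshift : Tendsto (fun x : EuclideanSpace ℝ (Fin n) ↦ x + y) (𝓝 0) (𝓝 y) :=
    (continuous_add_const y).tendsto' 0 y (zero_add y)
  have hw : ContDiff ℝ 1 w := by
    refine contDiff_iff_contDiffAt.2 fun x ↦ ?_
    by_cases hx : x ∈ tsupport w
    swap
    · exact contDiffAt_const.congr_of_eventuallyEq (notMem_tsupport_iff_eventuallyEq.1 hx)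
    have hx' : x ∈ Metric.closedBall (0 : EuclideanSpace ℝ (Fin n)) δ := by
      have := tsupport_smul_subset_left (χ : EuclideanSpace ℝ (Fin n) → ℝ) _ hx
      rwa [χ.tsupport_eq] at this
    refine χ.contDiff.contDiffAt.smul ?_
    exact (hφ (x + y) (by simpa [dist_eq_norm] using hx')).comp x
      (contDiffAt_id.add contDiffAt_const)
  have hws (x : EuclideanSpace ℝ (Fin n)) (hx : 1 < ‖x‖) : w x = 0 := by
    have : χ x = 0 := χ.zero_of_le_dist (by simpa [χ] using hδ1.trans hx.le)
    simp [w, this]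
  have hw0 : w =ᶠ[𝓝 0] 0 := by
    filter_upwards [hshift.eventually hy] with x hx
    simp [w, hx]
  have hwφ (x : EuclideanSpace ℝ (Fin n))
      (hx : x ∈ Metric.ball (0 : EuclideanSpace ℝ (Fin n)) (δ / 2)) : w x = φ (x + y) := by
    have : χ x = 1 := χ.one_of_mem_closedBall (Metric.ball_subset_closedBall hx)
    simp [w, this]
  have hDφ (x : EuclideanSpace ℝ (Fin n))
      (hx : x ∈ Metric.ball (0 : EuclideanSpace ℝ (Fin n)) (δ / 2)) :
      cliffordDirac g w x = cliffordDirac g φ (x + y) := by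
    have : w =ᶠ[𝓝 x] fun x ↦ φ (x + y) := by
      filter_upwards [Metric.isOpen_ball.mem_nhds hx] with z hz using hwφ z hz
    simp only [cliffordDirac, this.fderiv_eq, fderiv_comp_add_right]
  have hM (x : EuclideanSpace ℝ (Fin n))
      (hx : x ∈ Metric.ball (0 : EuclideanSpace ℝ (Fin n)) (δ / 2)) :
      h (cliffordDirac g w x) (cliffordDirac g w x) ≤ ‖h‖ * K ^ 2 * h (w x) (w x) := by
    rw [hDφ x hx, hwφ x hx]
    have h₁ := hK (x + y) (by simpa [dist_eq_norm] using hx)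
    have h₂ := (le_abs_self _).trans
      (h.le_opNorm₂ (cliffordDirac g φ (x + y)) (cliffordDirac g φ (x + y)))
    have h₃ : ‖cliffordDirac g φ (x + y)‖ ^ 2 ≤ (K * ‖φ (x + y)‖) ^ 2 := by gcongr
    calc _ ≤ ‖h‖ * ‖cliffordDirac g φ (x + y)‖ ^ 2 := h₂.trans_eq (by ring)
      _ ≤ ‖h‖ * (K * ‖φ (x + y)‖) ^ 2 := by gcongr
      _ = ‖h‖ * K ^ 2 * ‖φ (x + y)‖ ^ 2 := by ring
      _ ≤ _ := by gcongr; exact hpos _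
  intro x hx
  have hx' : x - y ∈ Metric.ball (0 : EuclideanSpace ℝ (Fin n)) (δ / 2) := by
    simpa [dist_eq_norm] using hx
  have := eqOn_zero_of_cliffordDirac_le hg hgh hsymm hpos hw hws hw0 (by positivity) hM _ hx'
  rwa [hwφ _ hx', sub_add_cancel] at this

end Local

/-- Unique continuation: a `C^{1,α}` solution of `Dφ = V(φ)` on a connected open set that
vanishes on a nonempty open subset vanishes identically. -/
theorem unique_continuation {n N : ℕ} (hn : 2 ≤ n) (hN : 1 ≤ N)
    (γ : Fin n → Matrix (Fin N) (Fin N) ℂ)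
    (hγ : ∀ i j, γ i * γ j + γ j * γ i = if i = j then (-2 : ℂ) • 1 else 0)
    (Ω : Set (EuclideanSpace ℝ (Fin n))) (hΩo : IsOpen Ω) (hΩc : IsConnected Ω)
    (α : ℝ) (hα : α ∈ Set.Ioo (0 : ℝ) 1)
    (φ : EuclideanSpace ℝ (Fin n) → EuclideanSpace ℂ (Fin N))
    (hφ : IsC1Holder α φ Ω)
    (V : EuclideanSpace ℂ (Fin N) → EuclideanSpace ℂ (Fin N))
    (hV0 : V 0 = 0)
    (hVlip : ∃ U ∈ nhds (0 : EuclideanSpace ℂ (Fin N)), ∃ K : NNReal, LipschitzOnWith K V U)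
    (heq : ∀ x ∈ Ω, dirac γ φ x = V (φ x))
    (hvanish : ∃ O : Set (EuclideanSpace ℝ (Fin n)),
      O.Nonempty ∧ IsOpen O ∧ O ⊆ Ω ∧ ∀ x ∈ O, φ x = 0) :
    ∀ x ∈ Ω, φ x = 0 := by
  obtain ⟨U, hU, K, hK⟩ := hVlip
  obtain ⟨O, ⟨o, ho⟩, hO, hOΩ, hOφ⟩ := hvanish
  obtain ⟨h, hsymm, hpos, hgh⟩ := exists_bilin_skew_clifford (matrixOp_clifford hγ)
    (h₀ := reInnerForm N)
    (fun u v ↦ by rw [reInnerForm_apply, reInnerForm_apply, ← inner_conj_symm, Complex.conj_re])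
    (fun u ↦ by
      rw [reInnerForm_apply, inner_self_eq_norm_sq_to_K]
      norm_cast)
  have hdiff (x) (hx : x ∈ Ω) : ContDiffAt ℝ 1 φ x := hφ.1.contDiffAt (hΩo.mem_nhds hx)
  have hint (z) (hz : z ∈ interior {x | φ x = 0}) : φ z = 0 :=
    interior_subset (s := {x | φ x = 0}) hz
  suffices Ω ⊆ interior {x | φ x = 0} from fun x hx ↦ hint x (this hx)
  refine hΩc.isPreconnected.subset_of_closure_inter_subset isOpen_interior
    ⟨o, hOΩ ho, interior_maximal hOφ hO ho⟩ ?_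
  rintro x ⟨hxcl, hxΩ⟩
  have hcont := (hdiff x hxΩ).continuousAt
  have hφx : φ x = 0 := by
    have h₁ : φ x ∈ closure (φ '' interior {x | φ x = 0}) :=
      hcont.continuousWithinAt.mem_closure_image hxcl
    have h₂ : φ '' interior {x | φ x = 0} ⊆ {0} := by
      rintro _ ⟨z, hz, rfl⟩
      exact hint z hz
    simpa using closure_mono h₂ h₁
  have hnhds : Ω ∩ φ ⁻¹' U ∈ nhds x :=
    Filter.inter_mem (hΩo.mem_nhds hxΩ) (hcont.preimage_mem_nhds (by rwa [hφx]))
  obtain ⟨ε, hε, hball⟩ := Metric.mem_nhds_iff.1 hnhds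
  obtain ⟨δ, hδ, hδ1, hδε⟩ : ∃ δ : ℝ, 0 < δ ∧ δ ≤ 1 ∧ 2 * δ ≤ ε :=
    ⟨min 1 (ε / 2), by positivity, min_le_left _ _, by linarith [min_le_right 1 (ε / 2)]⟩
  obtain ⟨y, hy, hxy⟩ := Metric.mem_closure_iff.1 hxcl (δ / 2) (by positivity)
  have hsub : Metric.closedBall y δ ⊆ Ω ∩ φ ⁻¹' U := by
    refine fun z hz ↦ hball ?_
    have h₁ := dist_triangle z y x
    rw [dist_comm y x] at h₁
    rw [Metric.mem_closedBall] at hz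
    rw [Metric.mem_ball]
    linarith
  have hzero := eqOn_ball_zero_of_cliffordDirac_le (φ := φ) (K := K) (matrixOp_clifford hγ) hgh
    hsymm hpos hδ hδ1 (fun z hz ↦ hdiff z (hsub hz).1)
    (by filter_upwards [isOpen_interior.mem_nhds hy] with z hz using hint z hz)
    (fun z hz ↦ by
      have hz' := hsub (Metric.ball_subset_closedBall
        (Metric.ball_subset_ball (by linarith) hz))
      rw [← dirac_eq_cliffordDirac, heq z hz'.1]
      simpa [hV0] using hK.norm_sub_le hz'.2 (mem_of_mem_nhds hU))
  exact mem_interior.2 ⟨_, hzero, Metric.isOpen_ball, hxy⟩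
end
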